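/- If D is a weighted acyclic tournament (a vertex-weighted oriented graph whose underlying graph is complete and which has no oriented cycles), then I(D)* = I(D)^∨, that is, Alexander duality holds for the edge ideal I(D). -/

import Mathlib

open MvPolynomial

noncomputable section

/-- An irreducible monomial ideal: an ideal of the form `(x_{i₁}^{a₁}, …, x_{i_r}^{a_r})`
with all exponents `a_j ≥ 1`. -/
def IsIrreducibleMonomialIdeal {n : ℕ} {K : Type*} [Field K]
    (L : Ideal (MvPolynomial (Fin n) K)) : Prop :=
  ∃ (s : Finset (Fin n)) (a : Fin n → ℕ), (∀ i ∈ s, 1 ≤ a i) ∧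
    L = Ideal.span ((fun i => (X i : MvPolynomial (Fin n) K) ^ a i) '' ↑s)

/-- `L` is a minimal irreducible monomial ideal of `I`: `L` is an irreducible monomial ideal
containing `I`, and every irreducible monomial ideal squeezed between `I` and `L` equals `L`. -/
def IsMinimalIrreducibleOf {n : ℕ} {K : Type*} [Field K]
    (I L : Ideal (MvPolynomial (Fin n) K)) : Prop :=
  IsIrreducibleMonomialIdeal L ∧ I ≤ L ∧
    ∀ L' : Ideal (MvPolynomial (Fin n) K),
      IsIrreducibleMonomialIdeal L' → I ≤ L' → L' ≤ L → L' = L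

/-- A vertex-weighted oriented graph on the vertex set `{x_1, …, x_n}`: a digraph with no
loops and no oriented cycles of length two, together with a positive integer weight `d i`
attached to each vertex. -/
structure WOG (n : ℕ) where
  E : Fin n → Fin n → Prop
  irrefl : ∀ i, ¬ E i i
  no_two_cycles : ∀ i j, E i j → ¬ E j i
  d : Fin n → ℕ
  dpos : ∀ i, 1 ≤ d i

/-- The edge ideal `I(D) = (x_i x_j^{d_j} : (x_i, x_j) ∈ E(D))` of a vertex-weighted
oriented graph `D`. -/
def edgeIdeal (K : Type*) [Field K] {n : ℕ} (D : WOG n) : Ideal (MvPolynomial (Fin n) K) :=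
  Ideal.span {f | ∃ i j, D.E i j ∧ f = X i * (X j : MvPolynomial (Fin n) K) ^ D.d j}

/-- The irreducible monomial ideal `({x_i^{a_i} : a_i ≥ 1})` attached to an exponent
vector `a`. -/
def pureIdeal {n : ℕ} (K : Type*) [Field K] (a : Fin n →₀ ℕ) :
    Ideal (MvPolynomial (Fin n) K) :=
  Ideal.span {g | ∃ i, 1 ≤ a i ∧ g = (X i : MvPolynomial (Fin n) K) ^ a i}

/-- The Alexander dual `I^∨` of a monomial ideal `I`: the ideal generated by the monomials
`x^a` such that `{x_i^{a_i} : a_i ≥ 1}` generates a minimal irreducible monomial ideal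
of `I` (i.e. the products of the minimal generators of the irreducible components of `I`). -/
def alexDual {n : ℕ} {K : Type*} [Field K] (I : Ideal (MvPolynomial (Fin n) K)) :
    Ideal (MvPolynomial (Fin n) K) :=
  Ideal.span {f | ∃ a : Fin n →₀ ℕ,
    IsMinimalIrreducibleOf I (pureIdeal K a) ∧ f = monomial a (1 : K)}

/-- A polynomial lies in `pureIdeal K a` iff each of its monomials is divisible by one of the
generators. -/
theorem mem_pureIdeal_iff {n : ℕ} {K : Type*} [Field K] {a : Fin n →₀ ℕ}
    {f : MvPolynomial (Fin n) K} :
    f ∈ pureIdeal K a ↔ ∀ b ∈ f.support, ∃ i, 1 ≤ a i ∧ a i ≤ b i := by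
  have h : pureIdeal K a = Ideal.span ((fun s => monomial s (1 : K)) ''
      ((fun i => Finsupp.single i (a i)) '' {i | 1 ≤ a i})) := by
    unfold pureIdeal
    congr 1
    ext g
    simp [X_pow_eq_monomial, eq_comm]
  rw [h, mem_ideal_span_monomial_image]
  simp [Finsupp.single_le_iff]

theorem monomial_mem_pureIdeal_iff {n : ℕ} {K : Type*} [Field K] {a b : Fin n →₀ ℕ} :
    monomial b (1 : K) ∈ pureIdeal K a ↔ ∃ i, 1 ≤ a i ∧ a i ≤ b i := by
  classical
  simp [mem_pureIdeal_iff, support_monomial]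

theorem pureIdeal_le_pureIdeal_iff {n : ℕ} {K : Type*} [Field K] {a b : Fin n →₀ ℕ} :
    pureIdeal K a ≤ pureIdeal K b ↔ ∀ i, 1 ≤ a i → 1 ≤ b i ∧ b i ≤ a i := by
  constructor
  · intro h i hi
    have hmem : monomial (Finsupp.single i (a i)) (1 : K) ∈ pureIdeal K a :=
      monomial_mem_pureIdeal_iff.2 ⟨i, hi, by simp⟩
    obtain ⟨j, hj, hji⟩ := monomial_mem_pureIdeal_iff.1 (h hmem)
    rcases eq_or_ne i j with rfl | hij
    · exact ⟨hj, by simpa using hji⟩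
    · rw [Finsupp.single_eq_of_ne' hij] at hji
      omega
  · intro h f hf
    rw [mem_pureIdeal_iff] at hf ⊢
    intro c hc
    obtain ⟨i, hi, hic⟩ := hf c hc
    exact ⟨i, (h i hi).1, (h i hi).2.trans hic⟩

theorem pureIdeal_injective {n : ℕ} (K : Type*) [Field K] :
    Function.Injective (pureIdeal K : (Fin n →₀ ℕ) → Ideal (MvPolynomial (Fin n) K)) := by
  intro a b h
  have hab := pureIdeal_le_pureIdeal_iff.1 h.le
  have hba := pureIdeal_le_pureIdeal_iff.1 h.ge
  ext i
  have := hab i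
  have := hba i
  omega

theorem isIrreducibleMonomialIdeal_iff {n : ℕ} {K : Type*} [Field K]
    {L : Ideal (MvPolynomial (Fin n) K)} :
    IsIrreducibleMonomialIdeal L ↔ ∃ a, L = pureIdeal K a := by
  classical
  constructor
  · rintro ⟨s, a, ha, rfl⟩
    refine ⟨Finsupp.equivFunOnFinite.symm fun i => if i ∈ s then a i else 0, ?_⟩
    unfold pureIdeal
    congr 1
    ext g
    constructor
    · rintro ⟨i, hi, rfl⟩
      have hi : i ∈ s := hi
      exact ⟨i, by simpa [hi] using ha i hi, by simp [hi]⟩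
    · rintro ⟨i, hi, rfl⟩
      have his : i ∈ s := by
        by_contra h
        simp [h] at hi
      exact ⟨i, his, by simp [his]⟩
  · rintro ⟨a, rfl⟩
    refine ⟨a.support, a, fun i hi => Nat.one_le_iff_ne_zero.2 (Finsupp.mem_support_iff.1 hi), ?_⟩
    unfold pureIdeal
    congr 1
    ext g
    simp [Nat.one_le_iff_ne_zero, eq_comm]

/-- Minimality among irreducible monomial ideals, expressed through exponent vectors. -/
theorem isMinimalIrreducibleOf_pureIdeal_iff {n : ℕ} {K : Type*} [Field K]
    {I : Ideal (MvPolynomial (Fin n) K)} {a : Fin n →₀ ℕ} :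
    IsMinimalIrreducibleOf I (pureIdeal K a) ↔
      I ≤ pureIdeal K a ∧ ∀ b, I ≤ pureIdeal K b → pureIdeal K b ≤ pureIdeal K a → b = a := by
  constructor
  · rintro ⟨-, hI, hmin⟩
    exact ⟨hI, fun b hb hba =>
      pureIdeal_injective K (hmin _ (isIrreducibleMonomialIdeal_iff.2 ⟨b, rfl⟩) hb hba)⟩
  · rintro ⟨hI, hmin⟩
    refine ⟨isIrreducibleMonomialIdeal_iff.2 ⟨a, rfl⟩, hI, fun L hL hIL hLa => ?_⟩
    obtain ⟨b, rfl⟩ := isIrreducibleMonomialIdeal_iff.1 hL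
    rw [hmin b hIL hLa]

theorem mem_alexDual_iff {n : ℕ} {K : Type*} [Field K] {I : Ideal (MvPolynomial (Fin n) K)}
    {f : MvPolynomial (Fin n) K} :
    f ∈ alexDual I ↔
      ∀ b ∈ f.support, ∃ a, IsMinimalIrreducibleOf I (pureIdeal K a) ∧ a ≤ b := by
  have h : alexDual I = Ideal.span ((fun s => monomial s (1 : K)) ''
      {a | IsMinimalIrreducibleOf I (pureIdeal K a)}) := by
    unfold alexDual
    congr 1
    ext g
    simp [eq_comm]
  rw [h, mem_ideal_span_monomial_image]
  simp

namespace WOG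

variable {n : ℕ} (D : WOG n)

theorem ne_of_edge {i j : Fin n} (h : D.E i j) : i ≠ j := by
  rintro rfl
  exact D.irrefl i h

theorem exists_edge_exponent_iff {i j : Fin n} (hij : D.E i j) (P : Fin n → ℕ → Prop) :
    (∃ l, 1 ≤ (Finsupp.single i 1 + Finsupp.single j (D.d j) : Fin n →₀ ℕ) l ∧
      P l ((Finsupp.single i 1 + Finsupp.single j (D.d j) : Fin n →₀ ℕ) l)) ↔ P i 1 ∨ P j (D.d j) := by
  have hne := D.ne_of_edge hij
  have hi : (Finsupp.single i 1 + Finsupp.single j (D.d j) : Fin n →₀ ℕ) i = 1 := by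
    simp [Finsupp.single_eq_of_ne hne]
  have hj : (Finsupp.single i 1 + Finsupp.single j (D.d j) : Fin n →₀ ℕ) j = D.d j := by
    simp [Finsupp.single_eq_of_ne' hne]
  constructor
  · rintro ⟨l, hl, hP⟩
    by_cases hli : l = i
    · subst hli
      rw [hi] at hP
      exact Or.inl hP
    by_cases hlj : l = j
    · subst hlj
      rw [hj] at hP
      exact Or.inr hP
    · simp [Finsupp.single_eq_of_ne hli, Finsupp.single_eq_of_ne hlj] at hl
  · rintro (h | h)
    · exact ⟨i, hi.ge, hi.symm ▸ h⟩
    · exact ⟨j, (D.dpos j).trans hj.ge, hj.symm ▸ h⟩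

theorem mem_dual_iff {K : Type*} [Field K] {f : MvPolynomial (Fin n) K} :
    f ∈ (⨅ e ∈ {q : Fin n × Fin n | D.E q.1 q.2},
        pureIdeal K (Finsupp.single e.1 1 + Finsupp.single e.2 (D.d e.2))) ↔
      ∀ b ∈ f.support, ∀ i j, D.E i j → 1 ≤ b i ∨ D.d j ≤ b j := by
  simp only [Ideal.mem_iInf, Set.mem_ofPred_eq, Prod.forall, mem_pureIdeal_iff]
  constructor
  · intro h b hb i j hij
    exact (D.exists_edge_exponent_iff hij fun l m => m ≤ b l).1 (h i j hij b hb)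
  · intro h i j hij b hb
    exact (D.exists_edge_exponent_iff hij fun l m => m ≤ b l).2 (h b hb i j hij)

theorem edgeIdeal_le_pureIdeal_iff {K : Type*} [Field K] {a : Fin n →₀ ℕ} :
    edgeIdeal K D ≤ pureIdeal K a ↔
      ∀ i j, D.E i j → a i = 1 ∨ (1 ≤ a j ∧ a j ≤ D.d j) := by
  have key : ∀ i j, D.E i j → ((X i * X j ^ D.d j : MvPolynomial (Fin n) K) ∈ pureIdeal K a ↔
      (a i = 1 ∨ (1 ≤ a j ∧ a j ≤ D.d j))) := by
    intro i j hij
    have hX : (X i * X j ^ D.d j : MvPolynomial (Fin n) K) =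
        monomial (Finsupp.single i 1 + Finsupp.single j (D.d j)) 1 := by
      rw [X_pow_eq_monomial, X, monomial_mul, one_mul]
    rw [hX, monomial_mem_pureIdeal_iff]
    have h := D.exists_edge_exponent_iff hij fun l m => 1 ≤ a l ∧ a l ≤ m
    constructor
    · rintro ⟨l, h1, h2⟩
      rcases h.1 ⟨l, h1.trans h2, h1, h2⟩ with h | h
      · exact Or.inl (le_antisymm h.2 h.1)
      · exact Or.inr h
    · intro h'
      obtain ⟨l, -, hl⟩ := h.2 (h'.imp_left fun h => ⟨h.ge, h.le⟩)
      exact ⟨l, hl⟩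
  unfold edgeIdeal
  rw [Ideal.span_le]
  constructor
  · exact fun h i j hij => (key i j hij).1 (h ⟨i, j, hij, rfl⟩)
  · rintro h _ ⟨i, j, hij, rfl⟩
    exact (key i j hij).2 (h i j hij)

open Classical in
/-- The exponent vector of the product of the in-neighbours `x_i` of `x_k` and of the powers
`x_j ^ d_j` over the remaining vertices `x_j` different from `x_k`. -/
def componentExponent (k : Fin n) : Fin n →₀ ℕ :=
  Finsupp.equivFunOnFinite.symm fun i => if i = k then 0 else if D.E i k then 1 else D.d i

theorem componentExponent_self (k : Fin n) : D.componentExponent k k = 0 := by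
  simp [componentExponent]

theorem componentExponent_of_edge_to {i k : Fin n} (h : D.E i k) :
    D.componentExponent k i = 1 := by
  simp [componentExponent, h, D.ne_of_edge h]

theorem componentExponent_of_edge_from {j k : Fin n} (h : D.E k j) :
    D.componentExponent k j = D.d j := by
  simp [componentExponent, D.no_two_cycles _ _ h, (D.ne_of_edge h).symm]

variable {D}

/-- In a nonempty acyclic oriented graph some vertex `k` has all its in-neighbours outside `P`,
and lies in `P` unless it is a sink. -/
theorem exists_first_or_sink [Nonempty (Fin n)]
    (hacyclic : ∀ i : Fin n, ¬ Relation.TransGen D.E i i) (P : Fin n → Prop) :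
    ∃ k, (∀ i, D.E i k → ¬ P i) ∧ ∀ j, D.E k j → P k := by
  have : Std.Irrefl (Relation.TransGen D.E) := ⟨hacyclic⟩
  by_cases hP : ∃ k, P k
  · obtain ⟨k, hk, hmin⟩ :=
      (Finite.wellFounded_of_trans_of_irrefl (Relation.TransGen D.E)).has_min {k | P k} hP
    exact ⟨k, fun i hik hi => hmin i hi (.single hik), fun _ _ => hk⟩
  · push Not at hP
    obtain ⟨k, -, hmax⟩ :=
      (Finite.wellFounded_of_trans_of_irrefl (Function.swap (Relation.TransGen D.E))).has_min
        Set.univ Set.univ_nonempty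
    exact ⟨k, fun i _ => hP i, fun j hkj => (hmax j trivial (.single hkj)).elim⟩

theorem edgeIdeal_le_pureIdeal_componentExponent
    (hcomplete : ∀ i j : Fin n, i ≠ j → D.E i j ∨ D.E j i) (K : Type*) [Field K] (k : Fin n) :
    edgeIdeal K D ≤ pureIdeal K (D.componentExponent k) := by
  rw [edgeIdeal_le_pureIdeal_iff]
  intro i j hij
  have := D.dpos j
  rcases eq_or_ne j k with rfl | hjk
  · exact Or.inl (D.componentExponent_of_edge_to hij)
  · rcases hcomplete j k hjk with h | h
    · rw [D.componentExponent_of_edge_to h]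
      omega
    · rw [D.componentExponent_of_edge_from h]
      omega

theorem isMinimalIrreducibleOf_componentExponent
    (hcomplete : ∀ i j : Fin n, i ≠ j → D.E i j ∨ D.E j i) (K : Type*) [Field K] (k : Fin n) :
    IsMinimalIrreducibleOf (edgeIdeal K D) (pureIdeal K (D.componentExponent k)) := by
  rw [isMinimalIrreducibleOf_pureIdeal_iff]
  refine ⟨edgeIdeal_le_pureIdeal_componentExponent hcomplete K k, fun b hb hle => ?_⟩
  rw [edgeIdeal_le_pureIdeal_iff] at hb
  rw [pureIdeal_le_pureIdeal_iff] at hle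
  have hbk : b k = 0 := by
    have := hle k
    rw [D.componentExponent_self] at this
    omega
  ext i
  rcases eq_or_ne i k with rfl | hik
  · rw [hbk, D.componentExponent_self]
  · have := hle i
    rcases hcomplete i k hik with h | h
    · have := hb i k h
      rw [D.componentExponent_of_edge_to h]
      omega
    · have := hb k i h
      rw [D.componentExponent_of_edge_from h] at *
      omega

theorem exists_pureIdeal_componentExponent_le [Nonempty (Fin n)]
    (hcomplete : ∀ i j : Fin n, i ≠ j → D.E i j ∨ D.E j i)
    (hacyclic : ∀ i : Fin n, ¬ Relation.TransGen D.E i i) {K : Type*} [Field K]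
    {a : Fin n →₀ ℕ} (ha : edgeIdeal K D ≤ pureIdeal K a) :
    ∃ k, pureIdeal K (D.componentExponent k) ≤ pureIdeal K a := by
  rw [edgeIdeal_le_pureIdeal_iff] at ha
  obtain ⟨k, hin, hout⟩ := exists_first_or_sink hacyclic fun i => a i ≠ 1
  refine ⟨k, pureIdeal_le_pureIdeal_iff.2 fun i hi => ?_⟩
  rcases eq_or_ne i k with rfl | hik
  · rw [D.componentExponent_self] at hi
    omega
  · rcases hcomplete i k hik with h | h
    · have := hin i h
      rw [D.componentExponent_of_edge_to h]
      omega
    · have := hout i h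
      have := ha k i h
      rw [D.componentExponent_of_edge_from h]
      omega

theorem exists_componentExponent_le [Nonempty (Fin n)]
    (hcomplete : ∀ i j : Fin n, i ≠ j → D.E i j ∨ D.E j i)
    (hacyclic : ∀ i : Fin n, ¬ Relation.TransGen D.E i i)
    {b : Fin n →₀ ℕ} (hb : ∀ i j, D.E i j → 1 ≤ b i ∨ D.d j ≤ b j) :
    ∃ k, D.componentExponent k ≤ b := by
  obtain ⟨k, hin, hout⟩ := exists_first_or_sink hacyclic fun i => b i = 0
  refine ⟨k, fun i => ?_⟩
  rcases eq_or_ne i k with rfl | hik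
  · simp [D.componentExponent_self]
  · rcases hcomplete i k hik with h | h
    · have := hin i h
      rw [D.componentExponent_of_edge_to h]
      omega
    · have := hout i h
      have := hb k i h
      rw [D.componentExponent_of_edge_from h]
      omega

theorem exists_eq_componentExponent [Nonempty (Fin n)]
    (hcomplete : ∀ i j : Fin n, i ≠ j → D.E i j ∨ D.E j i)
    (hacyclic : ∀ i : Fin n, ¬ Relation.TransGen D.E i i) {K : Type*} [Field K]
    {a : Fin n →₀ ℕ} (ha : IsMinimalIrreducibleOf (edgeIdeal K D) (pureIdeal K a)) :
    ∃ k, D.componentExponent k = a := by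
  rw [isMinimalIrreducibleOf_pureIdeal_iff] at ha
  obtain ⟨k, hk⟩ := exists_pureIdeal_componentExponent_le hcomplete hacyclic ha.1
  exact ⟨k, ha.2 _ (edgeIdeal_le_pureIdeal_componentExponent hcomplete K k) hk⟩

theorem one_le_componentExponent_or_le
    (hcomplete : ∀ i j : Fin n, i ≠ j → D.E i j ∨ D.E j i)
    {i j : Fin n} (hij : D.E i j) (k : Fin n) :
    1 ≤ D.componentExponent k i ∨ D.d j ≤ D.componentExponent k j := by
  rcases eq_or_ne i k with rfl | hik
  · exact Or.inr (D.componentExponent_of_edge_from hij).ge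
  · left
    rcases hcomplete i k hik with h | h
    · exact (D.componentExponent_of_edge_to h).ge
    · exact (D.dpos i).trans (D.componentExponent_of_edge_from h).ge

end WOG

/-- If `D` is a weighted acyclic tournament, then Alexander duality holds
for its edge ideal: `I(D)^* = I(D)^∨`. -/
theorem alexander_duality_of_acyclic_tournament
    {n : ℕ} (K : Type*) [Field K] (D : WOG n)
    (hcomplete : ∀ i j : Fin n, i ≠ j → D.E i j ∨ D.E j i)
    (hacyclic : ∀ i : Fin n, ¬ Relation.TransGen D.E i i) :
    (⨅ e ∈ {q : Fin n × Fin n | D.E q.1 q.2},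
        pureIdeal K (Finsupp.single e.1 1 + Finsupp.single e.2 (D.d e.2)))
      = alexDual (edgeIdeal K D) := by
  ext f
  rw [D.mem_dual_iff, mem_alexDual_iff]
  refine forall₂_congr fun b _ => ?_
  cases isEmpty_or_nonempty (Fin n) with
  | inl _ =>
    refine iff_of_true (fun i => isEmptyElim i) ⟨b, ?_, le_rfl⟩
    rw [isMinimalIrreducibleOf_pureIdeal_iff, D.edgeIdeal_le_pureIdeal_iff]
    exact ⟨fun i => isEmptyElim i, fun c _ _ => Subsingleton.elim c b⟩
  | inr _ =>
    constructor
    · intro hb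
      obtain ⟨k, hk⟩ := WOG.exists_componentExponent_le hcomplete hacyclic hb
      exact ⟨_, WOG.isMinimalIrreducibleOf_componentExponent hcomplete K k, hk⟩
    · rintro ⟨a, ha, hab⟩ i j hij
      obtain ⟨k, rfl⟩ := WOG.exists_eq_componentExponent hcomplete hacyclic ha
      exact (WOG.one_le_componentExponent_or_le hcomplete hij k).imp
        (fun h => h.trans (hab i)) fun h => h.trans (hab j)
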